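/- arXiv:1906.09243 — 4 statements merged into one kernel-verified Lean document; each statement's English description precedes it below -/
import Mathlib

section
/- For every measurable function s: 𝒳×𝒳 → ℝ₊ and every α ∈ (0,1) such that F_{s,−}(F_{s,−}^{−1}(α)) = α, one has ROC_s(α) ≤ ROC_η(α). Moreover, for every strictly increasing Borel function T defined on the support of the random variable η(X,X') and taking values in ℝ₊, one has ROC_{T∘η}(α) = ROC_η(α) for all α ∈ (0,1). -/
open MeasureTheory ProbabilityTheory

/-- If `η ∘ W` is a version of the conditional probability of `E` given `W`, then
`μ (E ∩ W ⁻¹' C) = ∫_{W ⁻¹' C} η ∘ W`. -/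
lemma measureReal_inter_preimage_eq_setIntegral {Ω β : Type*} [MeasurableSpace Ω]
    [MeasurableSpace β] (μ : Measure Ω) [IsProbabilityMeasure μ] {W : Ω → β}
    (hW : Measurable W) {E : Set Ω} (hE : MeasurableSet E) {η : β → ℝ}
    (h : μ[E.indicator (fun _ => (1 : ℝ)) | MeasurableSpace.comap W inferInstance]
      =ᵐ[μ] fun ω => η (W ω)) {C : Set β} (hC : MeasurableSet C) :
    μ.real (E ∩ W ⁻¹' C) = ∫ ω in W ⁻¹' C, η (W ω) ∂μ := by
  have hint : Integrable (E.indicator (fun _ => (1 : ℝ))) μ :=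
    (integrable_const (1 : ℝ)).indicator hE
  have hset := setIntegral_condExp (μ := μ) hW.comap_le hint (s := W ⁻¹' C) ⟨C, hC, rfl⟩
  rw [← integral_congr_ae (ae_restrict_of_ae h), hset, integral_indicator hE]
  simp [Measure.restrict_restrict hE]

/-- Real-valued form of the elementary conditional probability formula. -/
lemma measureReal_cond_apply {Ω : Type*} [MeasurableSpace Ω] (μ : Measure Ω) {E : Set Ω}
    (hE : MeasurableSet E) (A : Set Ω) :
    (μ[|E]).real A = (μ.real E)⁻¹ * μ.real (E ∩ A) := by
  simp [Measure.real, cond_apply hE]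

/-- Superlevel sets of `η` maximise `C ↦ ∫_C (η - t)`. -/
lemma setIntegral_sub_const_le_superlevel {Ω : Type*} [MeasurableSpace Ω] (μ : Measure Ω)
    [IsFiniteMeasure μ] {g : Ω → ℝ} (hg : Measurable g) (hgi : Integrable g μ) (t : ℝ)
    {A : Set Ω} (hA : MeasurableSet A) :
    ∫ ω in A, (g ω - t) ∂μ ≤ ∫ ω in {ω | t < g ω}, (g ω - t) ∂μ := by
  have hB : MeasurableSet {ω | t < g ω} := measurableSet_lt measurable_const hg
  have hi : Integrable (fun ω => g ω - t) μ := hgi.sub (integrable_const t)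
  rw [← integral_indicator hA, ← integral_indicator hB]
  refine integral_mono (hi.indicator hA) (hi.indicator hB) fun ω => ?_
  by_cases h1 : ω ∈ A <;> by_cases h2 : t < g ω <;>
    simp [Set.indicator, h1, h2] <;> linarith

/-- Neyman–Pearson: for a posterior probability `η ∘ W` of `E`, a superlevel set of `η` at level
`t < 1` has the largest `E`-mass among the `W`-measurable sets of the same `Eᶜ`-mass. -/
lemma measureReal_inter_le_superlevel {Ω β : Type*} [MeasurableSpace Ω]
    [MeasurableSpace β] (μ : Measure Ω) [IsProbabilityMeasure μ] {W : Ω → β}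
    (hW : Measurable W) {E : Set Ω} (hE : MeasurableSet E) {η : β → ℝ} (hη : Measurable η)
    (hηi : Integrable (fun ω => η (W ω)) μ)
    (h : μ[E.indicator (fun _ => (1 : ℝ)) | MeasurableSpace.comap W inferInstance]
      =ᵐ[μ] fun ω => η (W ω)) {t : ℝ} (ht : t < 1) {C : Set β} (hC : MeasurableSet C)
    (heq : μ.real (Eᶜ ∩ W ⁻¹' C) = μ.real (Eᶜ ∩ W ⁻¹' {p | t < η p})) :
    μ.real (E ∩ W ⁻¹' C) ≤ μ.real (E ∩ W ⁻¹' {p | t < η p}) := by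
  have key : ∀ D : Set β, MeasurableSet D → ∫ ω in W ⁻¹' D, (η (W ω) - t) ∂μ
      = (1 - t) * μ.real (E ∩ W ⁻¹' D) - t * μ.real (Eᶜ ∩ W ⁻¹' D) := by
    intro D hD
    rw [integral_sub hηi.integrableOn (integrable_const t),
      ← measureReal_inter_preimage_eq_setIntegral μ hW hE h hD]
    have h1 := measureReal_inter_add_sdiff (μ := μ) (s := W ⁻¹' D) hE
    rw [Set.sdiff_eq, Set.inter_comm, Set.inter_comm _ Eᶜ] at h1
    simp only [integral_const, measureReal_restrict_apply_univ, smul_eq_mul]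
    rw [← h1]
    ring
  have hle := setIntegral_sub_const_le_superlevel μ (hη.comp hW) hηi t (hW hC)
  have hB : MeasurableSet {p | t < η p} := measurableSet_lt measurable_const hη
  have e2 := key _ hB
  simp only [Set.preimage_ofPred_eq] at e2 heq ⊢
  simp only [Function.comp_apply] at hle
  rw [key _ hC, e2, heq] at hle
  have : 0 < 1 - t := by linarith
  exact le_of_mul_le_mul_left (by linarith) this

/-- A level set of the posterior probability at level `t < 1` that is `Eᶜ`-null is `E`-null. -/
lemma measureReal_inter_level_eq_zero {Ω β : Type*} [MeasurableSpace Ω]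
    [MeasurableSpace β] (μ : Measure Ω) [IsProbabilityMeasure μ] {W : Ω → β}
    (hW : Measurable W) {E : Set Ω} (hE : MeasurableSet E) {η : β → ℝ} (hη : Measurable η)
    (h : μ[E.indicator (fun _ => (1 : ℝ)) | MeasurableSpace.comap W inferInstance]
      =ᵐ[μ] fun ω => η (W ω)) {t : ℝ} (ht : t < 1)
    (h0 : μ.real (Eᶜ ∩ W ⁻¹' {p | η p = t}) = 0) :
    μ.real (E ∩ W ⁻¹' {p | η p = t}) = 0 := by
  have hD : MeasurableSet {p | η p = t} := hη (measurableSet_singleton t)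
  have h2 := measureReal_inter_preimage_eq_setIntegral μ hW hE h hD
  rw [setIntegral_congr_fun (g := fun _ => t) (hW hD) (fun ω hω => hω)] at h2
  have h1 := measureReal_inter_add_sdiff (μ := μ) (s := W ⁻¹' {p | η p = t}) hE
  rw [Set.sdiff_eq, Set.inter_comm, Set.inter_comm _ Eᶜ, h0] at h1
  simp only [integral_const, measureReal_restrict_apply_univ, smul_eq_mul] at h2
  rw [← h1] at h2
  have h3 : (1 - t) * μ.real (E ∩ W ⁻¹' {p | η p = t}) = 0 := by linarith
  exact (mul_eq_zero.mp h3).resolve_left (by linarith)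

/-- A random variable with values in `[0, 1]` and continuous strictly increasing distribution
function has superlevel sets of every probability `α ∈ (0, 1)`, and its survival function is at
most `α` exactly from the corresponding level on. -/
lemma exists_level_of_continuous_cdf {Ω : Type*} [MeasurableSpace Ω] (ν : Measure Ω)
    [IsProbabilityMeasure ν] {g : Ω → ℝ} (hg : Measurable g)
    (hg01 : ∀ ω, g ω ∈ Set.Icc (0 : ℝ) 1)
    (hc : Continuous fun t : ℝ => ν.real {ω | g ω ≤ t})
    (hm : StrictMonoOn (fun t : ℝ => ν.real {ω | g ω ≤ t}) (Set.Icc (0 : ℝ) 1))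
    {α : ℝ} (hα : α ∈ Set.Ioo (0 : ℝ) 1) :
    ∃ t ∈ Set.Ioo (0 : ℝ) 1, ν.real {ω | t < g ω} = α ∧
      ∀ u, 0 ≤ u → (ν.real {ω | u < g ω} ≤ α ↔ t ≤ u) := by
  have hsurv : ∀ t, ν.real {ω | t < g ω} = 1 - ν.real {ω | g ω ≤ t} := by
    intro t
    rw [← probReal_compl_eq_one_sub (measurableSet_le hg measurable_const)]
    congr 1
    ext ω
    simp
  have hG1 : ν.real {ω | g ω ≤ 1} = 1 := by
    rw [show {ω | g ω ≤ 1} = Set.univ from Set.eq_univ_of_forall fun ω => (hg01 ω).2]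
    simp
  have hG0 : ν.real {ω | g ω ≤ 0} = 0 := by
    have hlim := (hc.tendsto 0).mono_left (nhdsWithin_le_nhds (s := Set.Iio 0))
    refine tendsto_nhds_unique hlim (tendsto_const_nhds.congr' ?_)
    filter_upwards [self_mem_nhdsWithin] with t ht
    rw [show {ω | g ω ≤ t} = ∅ from Set.eq_empty_of_forall_notMem fun ω hω =>
      absurd ((hg01 ω).1.trans hω) (not_le.mpr ht)]
    simp
  have hmem : 1 - α ∈ Set.Ioo (ν.real {ω | g ω ≤ 0}) (ν.real {ω | g ω ≤ 1}) := by
    rw [hG0, hG1]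
    exact ⟨by linarith [hα.2], by linarith [hα.1]⟩
  obtain ⟨t, ht, hGt⟩ := intermediate_value_Ioo zero_le_one hc.continuousOn hmem
  simp only at hGt
  refine ⟨t, ht, by rw [hsurv, hGt]; ring, fun u hu => ?_⟩
  rw [hsurv]
  constructor
  · intro h
    by_contra! hlt
    have := hm ⟨hu, hlt.le.trans ht.2.le⟩ ⟨ht.1.le, ht.2.le⟩ hlt
    simp only at this
    linarith
  · intro h
    have : ν.real {ω | g ω ≤ t} ≤ ν.real {ω | g ω ≤ u} :=
      measureReal_mono fun ω hω => le_trans hω h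
    linarith

/-- The range of a random variable whose distribution function is strictly increasing on `[0, 1]`
meets every nondegenerate open subinterval of `[0, 1]`. -/
lemma exists_mem_Ioo_of_strictMonoOn_cdf {Ω : Type*} [MeasurableSpace Ω] (ν : Measure Ω)
    {g : Ω → ℝ}
    (hm : StrictMonoOn (fun t : ℝ => ν.real {ω | g ω ≤ t}) (Set.Icc (0 : ℝ) 1))
    {a b : ℝ} (ha : 0 ≤ a) (hab : a < b) (hb : b ≤ 1) : ∃ ω, g ω ∈ Set.Ioo a b := by
  by_contra! hne
  obtain ⟨m, ham, hmb⟩ := exists_between hab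
  have hlt := hm ⟨ha, by linarith⟩ ⟨by linarith, by linarith⟩ ham
  have heq : {ω | g ω ≤ m} = {ω | g ω ≤ a} := by
    ext ω
    refine ⟨fun (h : g ω ≤ m) => ?_, fun (h : g ω ≤ a) => h.trans ham.le⟩
    by_contra! hω
    exact hne ω ⟨not_le.mp hω, h.trans_lt hmb⟩
  simp [heq] at hlt

/-- The generalised inverse of the survival function of `T ∘ g`, for `T` strictly increasing on
the range of `g`, separates the values of `g` at the level `t` of probability `α`. -/
lemma superlevel_strictMono_comp_sandwich {Ω : Type*} [MeasurableSpace Ω] (ν : Measure Ω)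
    [IsProbabilityMeasure ν] {g : Ω → ℝ} (hg01 : ∀ ω, g ω ∈ Set.Icc (0 : ℝ) 1)
    (hc : ∀ u : ℝ, ν.real {ω | u ≤ g ω} = ν.real {ω | u < g ω})
    (hm : StrictMonoOn (fun t : ℝ => ν.real {ω | g ω ≤ t}) (Set.Icc (0 : ℝ) 1))
    {α t : ℝ} (ht : t ∈ Set.Ioo (0 : ℝ) 1)
    (hlevel : ∀ u, 0 ≤ u → (ν.real {ω | u < g ω} ≤ α ↔ t ≤ u))
    {T : ℝ → ℝ} (hT : StrictMonoOn T (Set.range g)) (hT0 : ∀ u ∈ Set.range g, 0 ≤ T u) :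
    {ω | t < g ω} ⊆ {ω | sInf {r : ℝ | 0 ≤ r ∧ ν.real {ω | r < T (g ω)} ≤ α} < T (g ω)} ∧
    {ω | sInf {r : ℝ | 0 ≤ r ∧ ν.real {ω | r < T (g ω)} ≤ α} < T (g ω)} ⊆ {ω | t ≤ g ω} := by
  set S := {r : ℝ | 0 ≤ r ∧ ν.real {ω | r < T (g ω)} ≤ α}
  have hbdd : BddBelow S := ⟨0, fun r hr => hr.1⟩
  have hmemS : ∀ ω, t < g ω → T (g ω) ∈ S := by
    intro ω hω
    refine ⟨hT0 _ ⟨ω, rfl⟩, ?_⟩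
    have : {ω' | T (g ω) < T (g ω')} = {ω' | g ω < g ω'} := by
      ext ω'
      exact hT.lt_iff_lt ⟨ω, rfl⟩ ⟨ω', rfl⟩
    rw [this]
    exact (hlevel _ (hg01 ω).1).2 hω.le
  constructor
  · intro ω (hω : t < g ω)
    obtain ⟨ω', h1, h2⟩ := exists_mem_Ioo_of_strictMonoOn_cdf ν hm ht.1.le hω (hg01 ω).2
    exact (csInf_le hbdd (hmemS ω' h1)).trans_lt (hT ⟨ω', rfl⟩ ⟨ω, rfl⟩ h2)
  · intro ω (hω : sInf S < T (g ω))
    obtain ⟨ω₁, h1, -⟩ := exists_mem_Ioo_of_strictMonoOn_cdf ν hm ht.1.le ht.2 le_rfl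
    obtain ⟨r, hr, hrω⟩ := exists_lt_of_csInf_lt ⟨_, hmemS ω₁ h1⟩ hω
    refine (hlevel _ (hg01 ω).1).1 (le_trans ?_ hr.2)
    rw [← hc]
    exact measureReal_mono fun ω' (h : g ω ≤ g ω') =>
      hrω.trans_le (hT.monotoneOn ⟨ω, rfl⟩ ⟨ω', rfl⟩ h)

/-- A real random variable with continuous distribution function has no atoms. -/
lemma measureReal_level_eq_zero_of_continuous_cdf {Ω : Type*} [MeasurableSpace Ω] (ν : Measure Ω)
    [IsFiniteMeasure ν] {g : Ω → ℝ} (hg : Measurable g)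
    (hc : Continuous fun t : ℝ => ν.real {ω | g ω ≤ t}) (u : ℝ) : ν.real {ω | g ω = u} = 0 := by
  have hlim : Filter.Tendsto (fun v => ν.real {ω | g ω ≤ u} - ν.real {ω | g ω ≤ v})
      (nhdsWithin u (Set.Iio u)) (nhds 0) := by
    have := (hc.tendsto u).mono_left (nhdsWithin_le_nhds (s := Set.Iio u))
    simpa using this.const_sub (ν.real {ω | g ω ≤ u})
  refine le_antisymm (ge_of_tendsto hlim ?_) measureReal_nonneg
  filter_upwards [self_mem_nhdsWithin] with v (hv : v < u)
  have hsub : {ω | g ω ≤ v} ⊆ {ω | g ω ≤ u} := fun ω (hω : g ω ≤ v) => hω.trans hv.le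
  rw [← measureReal_sdiff hsub (measurableSet_le hg measurable_const)]
  refine measureReal_mono fun ω (hω : g ω = u) => ⟨hω.le, ?_⟩
  simp [hω, hv]

/-- The pairwise posterior probability `η` is an optimal similarity function in
the ROC sense: `ROC_s(α) ≤ ROC_η(α)` at every `α ∈ (0,1)` with `F_{s,−}(F_{s,−}^{−1}(α)) = α`,
and any strictly increasing transform `T ∘ η` of `η` has the same ROC curve as `η`. -/
theorem roc_optimality_of_posterior
    {Ω : Type*} [MeasurableSpace Ω] (μ : Measure Ω) [IsProbabilityMeasure μ]
    (d K : ℕ) (hK : 1 ≤ K)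
    (X X' : Ω → (Fin d → ℝ)) (Y Y' : Ω → Fin K)
    (hX : Measurable X) (hX' : Measurable X') (hY : Measurable Y) (hY' : Measurable Y')
    (hindep : IndepFun (fun ω => (X ω, Y ω)) (fun ω => (X' ω, Y' ω)) μ)
    (hident : Measure.map (fun ω => (X ω, Y ω)) μ = Measure.map (fun ω => (X' ω, Y' ω)) μ)
    -- `0 < p_+ < 1`
    (hpos : 0 < μ {ω | Y ω = Y' ω}) (hpos' : μ {ω | Y ω = Y' ω} < 1)
    -- the pairwise posterior probability `η(x,x') = ℙ{Y = Y' ∣ (X,X') = (x,x')}`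
    (η : (Fin d → ℝ) × (Fin d → ℝ) → ℝ) (hηm : Measurable η)
    (hη01 : ∀ p, η p ∈ Set.Icc (0 : ℝ) 1)
    (hηver : μ[(fun ω => if Y ω = Y' ω then (1 : ℝ) else 0) |
        MeasurableSpace.comap (fun ω => (X ω, X' ω)) inferInstance]
      =ᵐ[μ] fun ω => η (X ω, X' ω))
    -- conditional "false/true positive rate" functions, generalized inverse and ROC
    (Fm Fp : ((Fin d → ℝ) × (Fin d → ℝ) → ℝ) → ℝ → ℝ)
    (hFm : ∀ s t, Fm s t = (μ[|{ω | Y ω ≠ Y' ω}] {ω | t < s (X ω, X' ω)}).toReal)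
    (hFp : ∀ s t, Fp s t = (μ[|{ω | Y ω = Y' ω}] {ω | t < s (X ω, X' ω)}).toReal)
    (inv : ((Fin d → ℝ) × (Fin d → ℝ) → ℝ) → ℝ → ℝ)
    (hinv : ∀ s α, inv s α = sInf {t : ℝ | 0 ≤ t ∧ Fm s t ≤ α})
    (ROC : ((Fin d → ℝ) × (Fin d → ℝ) → ℝ) → ℝ → ℝ)
    (hROC : ∀ s α, ROC s α = Fp s (inv s α))
    -- the conditional cdf of `η(X,X')` given `Z = −1` is invertible
    (hGcont : Continuous
      (fun t : ℝ => (μ[|{ω | Y ω ≠ Y' ω}] {ω | η (X ω, X' ω) ≤ t}).toReal))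
    (hGmono : StrictMonoOn
      (fun t : ℝ => (μ[|{ω | Y ω ≠ Y' ω}] {ω | η (X ω, X' ω) ≤ t}).toReal)
      (Set.Icc (0 : ℝ) 1)) :
    (∀ s : (Fin d → ℝ) × (Fin d → ℝ) → ℝ, Measurable s → (∀ p, 0 ≤ s p) →
        ∀ α ∈ Set.Ioo (0 : ℝ) 1, Fm s (inv s α) = α → ROC s α ≤ ROC η α) ∧
      (∀ T : ℝ → ℝ, Measurable T →
        StrictMonoOn T (Set.range fun ω => η (X ω, X' ω)) →
        (∀ u ∈ Set.range fun ω => η (X ω, X' ω), 0 ≤ T u) →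
        ∀ α ∈ Set.Ioo (0 : ℝ) 1, ROC (T ∘ η) α = ROC η α) := by
  set W : Ω → (Fin d → ℝ) × (Fin d → ℝ) := fun ω => (X ω, X' ω) with hWdef
  have hW : Measurable W := hX.prodMk hX'
  set E : Set Ω := {ω | Y ω = Y' ω} with hEdef
  have hE : MeasurableSet E := measurableSet_eq_fun hY hY'
  have hEc : {ω | Y ω ≠ Y' ω} = Eᶜ := rfl
  rw [hEc] at hGcont hGmono
  simp only [hEc] at hFm
  have hver : μ[E.indicator (fun _ => (1 : ℝ)) | MeasurableSpace.comap W inferInstance]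
      =ᵐ[μ] fun ω => η (W ω) := by
    convert hηver using 3
    simp [Set.indicator, hEdef]
  have hEc0 : μ Eᶜ ≠ 0 := by
    rw [Ne, prob_compl_eq_zero_iff hE]
    exact hpos'.ne
  have hE0 : μ E ≠ 0 := hpos.ne'
  have : IsProbabilityMeasure (μ[|Eᶜ]) := cond_isProbabilityMeasure hEc0
  have : IsProbabilityMeasure (μ[|E]) := cond_isProbabilityMeasure hE0
  have hg : Measurable fun ω => η (W ω) := hηm.comp hW
  have hg01 : ∀ ω, η (W ω) ∈ Set.Icc (0 : ℝ) 1 := fun ω => hη01 _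
  have hgi : Integrable (fun ω => η (W ω)) μ :=
    Integrable.of_mem_Icc 0 1 hg.aemeasurable (ae_of_all _ hg01)
  have hatom : ∀ u, (μ[|Eᶜ]).real {ω | η (W ω) = u} = 0 :=
    measureReal_level_eq_zero_of_continuous_cdf _ hg hGcont
  have hinvη : ∀ α t : ℝ, t ∈ Set.Ioo (0 : ℝ) 1 →
      (∀ u, 0 ≤ u → ((μ[|Eᶜ]).real {ω | u < η (W ω)} ≤ α ↔ t ≤ u)) → inv η α = t := by
    intro α t ht hl
    rw [hinv]
    have : {u : ℝ | 0 ≤ u ∧ Fm η u ≤ α} = Set.Ici t := by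
      ext u
      rw [Set.mem_ofPred_eq, hFm]
      exact ⟨fun h => (hl u h.1).1 h.2, fun h => ⟨ht.1.le.trans h, (hl u (ht.1.le.trans h)).2 h⟩⟩
    rw [this, csInf_Ici]
  refine ⟨fun s hs _ α hα hsα => ?_, fun T _ hT hT0 α hα => ?_⟩
  · obtain ⟨t, ht, htα, hl⟩ := exists_level_of_continuous_cdf _ hg hg01 hGcont hGmono hα
    rw [hROC, hROC, hinvη α t ht hl, hFp, hFp]
    change (μ[|E]).real (W ⁻¹' {p | inv s α < s p}) ≤ (μ[|E]).real (W ⁻¹' {p | t < η p})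
    rw [measureReal_cond_apply μ hE, measureReal_cond_apply μ hE]
    refine mul_le_mul_of_nonneg_left ?_ (by positivity)
    refine measureReal_inter_le_superlevel μ hW hE hηm hgi hver ht.2
      (measurableSet_lt measurable_const hs) ?_
    have h1 : (μ[|Eᶜ]).real (W ⁻¹' {p | inv s α < s p})
        = (μ[|Eᶜ]).real (W ⁻¹' {p | t < η p}) := by
      rw [hFm] at hsα
      exact hsα.trans htα.symm
    rw [measureReal_cond_apply μ hE.compl, measureReal_cond_apply μ hE.compl] at h1
    exact mul_left_cancel₀ (inv_ne_zero ((measureReal_ne_zero_iff).2 hEc0)) h1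
  · obtain ⟨t, ht, -, hl⟩ := exists_level_of_continuous_cdf _ hg hg01 hGcont hGmono hα
    have hc : ∀ u : ℝ, (μ[|Eᶜ]).real {ω | u ≤ η (W ω)} = (μ[|Eᶜ]).real {ω | u < η (W ω)} := by
      intro u
      refine le_antisymm ?_ (measureReal_mono fun ω (h : u < η (W ω)) => h.le)
      calc (μ[|Eᶜ]).real {ω | u ≤ η (W ω)}
          ≤ (μ[|Eᶜ]).real ({ω | u < η (W ω)} ∪ {ω | η (W ω) = u}) :=
            measureReal_mono fun ω (h : u ≤ η (W ω)) => h.lt_or_eq.imp_right Eq.symm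
        _ ≤ _ := (measureReal_union_le _ _).trans_eq (by rw [hatom, add_zero])
    obtain ⟨hsub, hsup⟩ := superlevel_strictMono_comp_sandwich _ hg01 hc hGmono ht hl hT hT0
    have hnull : (μ[|E]).real {ω | η (W ω) = t} = 0 := by
      have h0 := hatom t
      rw [measureReal_cond_apply μ hE.compl] at h0
      rw [measureReal_cond_apply μ hE]
      refine mul_eq_zero_of_right _ (measureReal_inter_level_eq_zero μ hW hE hηm hver ht.2 ?_)
      exact (mul_eq_zero.mp h0).resolve_left
        (inv_ne_zero ((measureReal_ne_zero_iff).2 hEc0))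
    rw [hROC, hROC, hinvη α t ht hl, hinv, hFp, hFp]
    simp only [hFm]
    refine le_antisymm ?_ (measureReal_mono hsub)
    refine (measureReal_mono (h₂ := measure_ne_top _ _) (hsup.trans
      fun ω (h : t ≤ η (W ω)) => h.lt_or_eq.imp_right Eq.symm)).trans
      ((measureReal_union_le {ω | t < η (W ω)} {ω | η (W ω) = t}).trans_eq ?_)
    rw [hnull, add_zero]
    rfl
end

section
/- Fix α ∈ (0,1), let Q*_α denote the quantile of order 1−α of the conditional distribution of η(X,X') given Z = −1, assume Q*_α < 1, and set R*_α = {(x,x') ∈ 𝒳×𝒳 : η(x,x') ≥ Q*_α}. If a Borel measurable function s: 𝒳×𝒳 → [0,1] satisfies 𝔼[s(X,X') ∣ Z=−1] ≤ α and 𝔼[s(X,X') ∣ Z=+1] = 𝔼[𝟙_{R*_α}(X,X') ∣ Z=+1], then s = 𝟙_{R*_α} almost everywhere with respect to the distribution of (X,X'); i.e. the indicator of R*_α is the unique solution of the problem of maximizing 𝔼[s(X,X') ∣ Z=+1] over Borel s: 𝒳×𝒳 → [0,1] subject to 𝔼[s(X,X') ∣ Z=−1] ≤ α. -/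
open MeasureTheory ProbabilityTheory

/-- A random variable with continuous cumulative distribution function has no atoms. -/
theorem measure_eq_zero_of_continuous_cdf {Ω : Type*} [MeasurableSpace Ω] {ν : Measure Ω}
    [IsFiniteMeasure ν] {W : Ω → ℝ} (hW : Measurable W)
    (hcont : Continuous fun t : ℝ => (ν {ω | W ω ≤ t}).toReal) (a : ℝ) :
    ν {ω | W ω = a} = 0 := by
  have hle : ∀ t < a, (ν {ω | W ω = a}).toReal
      ≤ (ν {ω | W ω ≤ a}).toReal - (ν {ω | W ω ≤ t}).toReal := by
    intro t ht
    have hdisj : Disjoint {ω | W ω = a} {ω | W ω ≤ t} := by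
      rw [Set.disjoint_left]
      intro ω (h1 : W ω = a) (h2 : W ω ≤ t)
      linarith
    have hunion := measureReal_union (μ := ν) hdisj (measurableSet_le hW measurable_const)
    have hsub : ν.real ({ω | W ω = a} ∪ {ω | W ω ≤ t}) ≤ ν.real {ω | W ω ≤ a} :=
      measureReal_mono (by
        rintro ω (h | h)
        · exact le_of_eq h
        · exact le_trans h ht.le)
    simp only [measureReal_def] at hunion hsub
    linarith
  have hlim : Filter.Tendsto
      (fun t => (ν {ω | W ω ≤ a}).toReal - (ν {ω | W ω ≤ t}).toReal)
      (nhdsWithin a (Set.Iio a)) (nhds 0) := by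
    have h := (tendsto_const_nhds (x := (ν {ω | W ω ≤ a}).toReal)).sub
      (hcont.tendsto a |>.mono_left (nhdsWithin_le_nhds (s := Set.Iio a)))
    simpa using h
  have h0 : (ν {ω | W ω = a}).toReal ≤ 0 :=
    ge_of_tendsto hlim (Filter.eventually_of_mem self_mem_nhdsWithin hle)
  have h1 : (ν {ω | W ω = a}).toReal = 0 := le_antisymm h0 ENNReal.toReal_nonneg
  exact (ENNReal.toReal_eq_zero_iff _).1 h1 |>.resolve_right (measure_ne_top _ _)

/-- If `η ∘ T` is the posterior probability of `A` given `T`, integrals over `A` of bounded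
functions of `T` are obtained by integrating against `η ∘ T`. -/
theorem setIntegral_comp_eq_integral_mul_posterior {Ω E : Type*} [MeasurableSpace Ω]
    [MeasurableSpace E] {μ : Measure Ω} [IsFiniteMeasure μ] {T : Ω → E} (hT : Measurable T)
    {A : Set Ω} (hA : MeasurableSet A) {η : E → ℝ}
    (hη : μ[A.indicator (fun _ => (1 : ℝ)) | MeasurableSpace.comap T inferInstance]
      =ᵐ[μ] fun ω => η (T ω))
    {g : E → ℝ} (hg : Measurable g) {C : ℝ} (hC : ∀ p, |g p| ≤ C) :
    ∫ ω in A, g (T ω) ∂μ = ∫ ω, g (T ω) * η (T ω) ∂μ := by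
  have hm := hT.comap_le
  have hint : Integrable (A.indicator (fun _ => (1 : ℝ))) μ :=
    (integrable_const 1).indicator hA
  have hgT : Integrable (fun ω => g (T ω)) μ :=
    Integrable.of_bound (hg.comp hT).aestronglyMeasurable C (ae_of_all _ fun ω => hC _)
  have heq : (fun ω => g (T ω)) * A.indicator (fun _ => (1 : ℝ))
      = A.indicator fun ω => g (T ω) := by
    ext ω
    by_cases h : ω ∈ A <;> simp [h]
  have hpull := condExp_mul_of_stronglyMeasurable_left
    (m := MeasurableSpace.comap T inferInstance) (μ := μ) (f := fun ω => g (T ω))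
    (hg.comp (comap_measurable T)).stronglyMeasurable
    (by rw [heq]; exact hgT.indicator hA) hint
  rw [← integral_indicator hA, ← heq, ← integral_condExp hm]
  refine integral_congr_ae ?_
  filter_upwards [hpull, hη] with ω h1 h2
  rw [h1, Pi.mul_apply, h2]

theorem integral_cond_eq {Ω : Type*} [MeasurableSpace Ω] (μ : Measure Ω) (A : Set Ω)
    (f : Ω → ℝ) : ∫ ω, f ω ∂μ[|A] = (μ.real A)⁻¹ * ∫ ω in A, f ω ∂μ := by
  rw [ProbabilityTheory.cond, integral_smul_measure, ENNReal.toReal_inv, smul_eq_mul,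
    measureReal_def]

/-- Uniqueness of the Neyman-Pearson test `𝟙{η ≥ Q}`, where `η ∘ T` is the posterior probability
of `A` given `T`. -/
theorem ae_eq_indicator_superlevel_of_power_eq {Ω E : Type*} [MeasurableSpace Ω]
    [MeasurableSpace E] {μ : Measure Ω} [IsProbabilityMeasure μ] {T : Ω → E} (hT : Measurable T)
    {A : Set Ω} (hA : MeasurableSet A) (hpos : μ A ≠ 0) (hpos' : μ Aᶜ ≠ 0)
    {η : E → ℝ} (hηm : Measurable η) (hη01 : ∀ p, η p ∈ Set.Icc (0 : ℝ) 1)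
    (hη : μ[A.indicator (fun _ => (1 : ℝ)) | MeasurableSpace.comap T inferInstance]
      =ᵐ[μ] fun ω => η (T ω))
    (hcont : Continuous fun t : ℝ => (μ[|Aᶜ] {ω | η (T ω) ≤ t}).toReal)
    {α : ℝ} (hα : α < 1) {Q : ℝ} (hQlt : Q < 1)
    (hQ : (μ[|Aᶜ] {ω | η (T ω) ≤ Q}).toReal = 1 - α)
    {s : E → ℝ} (hsm : Measurable s) (hs01 : ∀ p, s p ∈ Set.Icc (0 : ℝ) 1)
    (hsfpr : ∫ ω, s (T ω) ∂μ[|Aᶜ] ≤ α)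
    (hstpr : ∫ ω, s (T ω) ∂μ[|A] =
      ∫ ω, Set.indicator {p | Q ≤ η p} (fun _ => (1 : ℝ)) (T ω) ∂μ[|A]) :
    s =ᵐ[μ.map T] Set.indicator {p | Q ≤ η p} (fun _ => (1 : ℝ)) := by
  have hprob : IsProbabilityMeasure μ[|Aᶜ] := cond_isProbabilityMeasure hpos'
  set r : E → ℝ := Set.indicator {p | Q ≤ η p} (fun _ => (1 : ℝ)) with hr
  have hRm : MeasurableSet {p | Q ≤ η p} := measurableSet_le measurable_const hηm
  have hrm : Measurable r := measurable_const.indicator hRm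
  have hr01 : ∀ p, r p ∈ Set.Icc (0 : ℝ) 1 := by
    intro p
    by_cases h : Q ≤ η p <;> simp [hr, h]
  have bdd : ∀ (ν : Measure Ω) [IsFiniteMeasure ν] {g : E → ℝ}, Measurable g →
      (∀ p, |g p| ≤ 1) → Integrable (fun ω => g (T ω)) ν := fun ν _ g hg h =>
    Integrable.of_bound (hg.comp hT).aestronglyMeasurable 1 (ae_of_all _ fun ω => h _)
  have abs01 : ∀ {x : ℝ}, x ∈ Set.Icc (0 : ℝ) 1 → |x| ≤ 1 := fun h =>
    abs_le.2 ⟨by linarith [h.1], h.2⟩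
  have hWm : Measurable fun ω => η (T ω) := hηm.comp hT
  have hatom := measure_eq_zero_of_continuous_cdf hWm hcont Q
  have hQpos : 0 < Q := by
    by_contra! hneg
    have hsub : {ω | η (T ω) ≤ Q} ⊆ {ω | η (T ω) = Q} := fun ω (h : η (T ω) ≤ Q) =>
      le_antisymm h (hneg.trans (hη01 _).1)
    rw [measure_mono_null hsub hatom] at hQ
    simp at hQ
    linarith
  have hrfpr : ∫ ω, r (T ω) ∂μ[|Aᶜ] = α := by
    have hae : (fun ω => r (T ω)) =ᵐ[μ[|Aᶜ]]
        {ω | η (T ω) ≤ Q}ᶜ.indicator (fun _ => (1 : ℝ)) := by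
      have hne : ∀ᵐ ω ∂μ[|Aᶜ], η (T ω) ≠ Q := by
        rw [ae_iff]; simpa using hatom
      filter_upwards [hne] with ω hω
      by_cases h : Q ≤ η (T ω)
      · have : Q < η (T ω) := lt_of_le_of_ne h hω.symm
        simp [hr, Set.indicator, h, this]
      · simp [hr, Set.indicator, h, (not_le.1 h).le]
    have hmeas : MeasurableSet {ω | η (T ω) ≤ Q} := measurableSet_le hWm measurable_const
    rw [integral_congr_ae hae, integral_indicator_const _ hmeas.compl,
      probReal_compl_eq_one_sub hmeas, measureReal_def, hQ]
    simp
  let D : E → ℝ := fun p => r p - s p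
  have hDm : Measurable D := hrm.sub hsm
  have hD1 : ∀ p, |D p| ≤ 1 := fun p => by
    have h1 := hr01 p
    have h2 := hs01 p
    exact abs_le.2 ⟨by simp only [D]; linarith [h1.1, h2.2], by
      simp only [D]; linarith [h1.2, h2.1]⟩
  have hsplit : ∀ (ν : Measure Ω) [IsFiniteMeasure ν],
      ∫ ω, D (T ω) ∂ν = ∫ ω, r (T ω) ∂ν - ∫ ω, s (T ω) ∂ν := fun ν _ =>
    integral_sub (bdd ν hrm fun p => abs01 (hr01 p)) (bdd ν hsm fun p => abs01 (hs01 p))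
  have hDA : ∫ ω in A, D (T ω) ∂μ = 0 := by
    have h := hsplit μ[|A]
    rw [hstpr, sub_self, integral_cond_eq] at h
    refine (mul_eq_zero.1 h).resolve_left (inv_ne_zero ?_)
    exact (measureReal_ne_zero_iff).2 hpos
  have hDAc : 0 ≤ ∫ ω in Aᶜ, D (T ω) ∂μ := by
    have h := hsplit μ[|Aᶜ]
    rw [hrfpr, integral_cond_eq] at h
    have hp : 0 < (μ.real Aᶜ)⁻¹ := inv_pos.2 <|
      measureReal_nonneg.lt_of_ne' ((measureReal_ne_zero_iff).2 hpos')
    exact nonneg_of_mul_nonneg_right (by linarith) hp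
  have hDint := bdd μ hDm hD1
  have hDηm : Measurable fun p => D p * η p := hDm.mul hηm
  have hDηint : Integrable (fun ω => D (T ω) * η (T ω)) μ :=
    bdd μ hDηm fun p => by
      rw [abs_mul]
      exact mul_le_one₀ (hD1 p) (abs_nonneg _) (abs01 (hη01 p))
  have hkey : ∀ p, 0 ≤ D p * (η p - Q) := by
    intro p
    by_cases h : Q ≤ η p
    · have : r p = 1 := by simp [hr, h]
      exact mul_nonneg (by simp only [D]; linarith [(hs01 p).2]) (by linarith)
    · have : r p = 0 := by simp [hr, h]
      exact mul_nonneg_of_nonpos_of_nonpos (by simp only [D]; linarith [(hs01 p).1])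
        (by linarith)
  have hfun : (fun ω => D (T ω) * (η (T ω) - Q))
      = fun ω => D (T ω) * η (T ω) - Q * D (T ω) := by
    ext ω; ring
  have hkeyint : Integrable (fun ω => D (T ω) * (η (T ω) - Q)) μ := by
    rw [hfun]; exact hDηint.sub (hDint.const_mul Q)
  have hzero : ∫ ω, D (T ω) * (η (T ω) - Q) ∂μ = 0 := by
    refine le_antisymm ?_ (integral_nonneg fun ω => hkey _)
    rw [hfun, integral_sub hDηint (hDint.const_mul Q), integral_const_mul,
      ← setIntegral_comp_eq_integral_mul_posterior hT hA hη hDm hD1, hDA,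
      ← integral_add_compl hA hDint, hDA]
    have := mul_nonneg hQpos.le hDAc
    linarith
  have hDzero := (integral_eq_zero_iff_of_nonneg (fun ω => hkey (T ω)) hkeyint).1 hzero
  have hlevel : ∀ᵐ ω ∂μ, η (T ω) ≠ Q := by
    set B : Set E := {p | η p = Q} with hB
    have hBm : MeasurableSet B := measurableSet_eq_fun hηm measurable_const
    have hB0 : μ (Aᶜ ∩ T ⁻¹' B) = 0 := by
      have h : μ[|Aᶜ] (T ⁻¹' B) = 0 := hatom
      rw [cond_apply hA.compl] at h
      exact (mul_eq_zero.1 h).resolve_left (ENNReal.inv_ne_zero.2 (measure_ne_top _ _))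
    have hpost := setIntegral_comp_eq_integral_mul_posterior hT hA hη
      (g := B.indicator fun _ => (1 : ℝ)) (measurable_const.indicator hBm) (C := 1)
      (fun p => by by_cases h : p ∈ B <;> simp [h])
    have hleft : ∫ ω in A, B.indicator (fun _ => (1 : ℝ)) (T ω) ∂μ = μ.real (T ⁻¹' B) := by
      have : (fun ω => B.indicator (fun _ => (1 : ℝ)) (T ω))
          = (T ⁻¹' B).indicator fun _ => (1 : ℝ) := rfl
      rw [this, integral_indicator_const _ (hT hBm), measureReal_restrict_apply (hT hBm)]
      have hsum := measureReal_inter_add_sdiff (μ := μ) (s := T ⁻¹' B) hA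
      have hd : μ.real (T ⁻¹' B \ A) = 0 := by
        rw [measureReal_def, Set.sdiff_eq, Set.inter_comm, hB0, ENNReal.toReal_zero]
      rw [smul_eq_mul, mul_one]
      linarith
    have hright : ∫ ω, B.indicator (fun _ => (1 : ℝ)) (T ω) * η (T ω) ∂μ
        = μ.real (T ⁻¹' B) * Q := by
      have : (fun ω => B.indicator (fun _ => (1 : ℝ)) (T ω) * η (T ω))
          = (T ⁻¹' B).indicator fun _ => Q := by
        ext ω
        by_cases h : η (T ω) = Q <;> simp [hB, Set.indicator, h]
      rw [this, integral_indicator_const _ (hT hBm), smul_eq_mul]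
    rw [hleft, hright] at hpost
    have hnull : μ.real (T ⁻¹' B) = 0 := by
      have h : μ.real (T ⁻¹' B) * (1 - Q) = 0 := by linarith
      exact (mul_eq_zero.1 h).resolve_right (by linarith)
    rw [ae_iff]
    simpa [hB] using (measureReal_eq_zero_iff).1 hnull
  rw [Filter.EventuallyEq, ae_map_iff hT.aemeasurable (measurableSet_eq_fun hsm hrm)]
  filter_upwards [hDzero, hlevel] with ω h1 h2
  have h3 : D (T ω) = 0 := (mul_eq_zero.1 h1).resolve_right (sub_ne_zero.2 h2)
  exact (sub_eq_zero.1 h3).symm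

/-- Uniqueness in the pointwise ROC optimization problem: any `[0,1]`-valued
Borel test with false positive rate `≤ α` achieving the true positive rate of the superlevel
set `R*_α = {η ≥ Q*_α}` (with `Q*_α < 1`) coincides with `𝟙_{R*_α}` almost everywhere with
respect to the distribution of `(X,X')`. -/
theorem superlevel_set_unique_solution_pointwise_roc
    {Ω : Type*} [MeasurableSpace Ω] (μ : Measure Ω) [IsProbabilityMeasure μ]
    (d K : ℕ) (hK : 1 ≤ K)
    (X X' : Ω → (Fin d → ℝ)) (Y Y' : Ω → Fin K)
    (hX : Measurable X) (hX' : Measurable X') (hY : Measurable Y) (hY' : Measurable Y')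
    (hindep : IndepFun (fun ω => (X ω, Y ω)) (fun ω => (X' ω, Y' ω)) μ)
    (hident : Measure.map (fun ω => (X ω, Y ω)) μ = Measure.map (fun ω => (X' ω, Y' ω)) μ)
    -- `0 < p_+ < 1`
    (hpos : 0 < μ {ω | Y ω = Y' ω}) (hpos' : μ {ω | Y ω = Y' ω} < 1)
    -- the pairwise posterior probability `η(x,x') = ℙ{Y = Y' ∣ (X,X') = (x,x')}`
    (η : (Fin d → ℝ) × (Fin d → ℝ) → ℝ) (hηm : Measurable η)
    (hη01 : ∀ p, η p ∈ Set.Icc (0 : ℝ) 1)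
    (hηver : μ[(fun ω => if Y ω = Y' ω then (1 : ℝ) else 0) |
        MeasurableSpace.comap (fun ω => (X ω, X' ω)) inferInstance]
      =ᵐ[μ] fun ω => η (X ω, X' ω))
    -- the conditional cdf of `η(X,X')` given `Z = −1` is invertible
    (hGcont : Continuous
      (fun t : ℝ => (μ[|{ω | Y ω ≠ Y' ω}] {ω | η (X ω, X' ω) ≤ t}).toReal))
    (hGmono : StrictMonoOn
      (fun t : ℝ => (μ[|{ω | Y ω ≠ Y' ω}] {ω | η (X ω, X' ω) ≤ t}).toReal)
      (Set.Icc (0 : ℝ) 1))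
    -- `α ∈ (0,1)` and `Q*_α < 1`, the quantile of order `1 − α` of the conditional
    -- distribution of `η(X,X')` given `Z = −1`
    (α : ℝ) (hα : α ∈ Set.Ioo (0 : ℝ) 1) (Q : ℝ) (hQlt : Q < 1)
    (hQ : (μ[|{ω | Y ω ≠ Y' ω}] {ω | η (X ω, X' ω) ≤ Q}).toReal = 1 - α)
    -- a candidate test `s` attaining the optimal true positive rate
    (s : (Fin d → ℝ) × (Fin d → ℝ) → ℝ) (hsm : Measurable s)
    (hs01 : ∀ p, s p ∈ Set.Icc (0 : ℝ) 1)
    (hsfpr : (∫ ω, s (X ω, X' ω) ∂(μ[|{ω | Y ω ≠ Y' ω}])) ≤ α)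
    (hstpr : (∫ ω, s (X ω, X' ω) ∂(μ[|{ω | Y ω = Y' ω}])) =
      ∫ ω, Set.indicator {p | Q ≤ η p} (fun _ => (1 : ℝ)) (X ω, X' ω)
        ∂(μ[|{ω | Y ω = Y' ω}])) :
    s =ᵐ[Measure.map (fun ω => (X ω, X' ω)) μ]
      Set.indicator {p | Q ≤ η p} (fun _ => (1 : ℝ)) := by
  have hA : MeasurableSet {ω | Y ω = Y' ω} := measurableSet_eq_fun hY hY'
  have hη : μ[Set.indicator {ω | Y ω = Y' ω} (fun _ => (1 : ℝ)) |
        MeasurableSpace.comap (fun ω => (X ω, X' ω)) inferInstance]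
      =ᵐ[μ] fun ω => η (X ω, X' ω) := by
    convert hηver using 2
    ext ω
    simp [Set.indicator]
  have hcompl : μ {ω | Y ω = Y' ω}ᶜ ≠ 0 := fun h =>
    hpos'.ne ((prob_compl_eq_zero_iff hA).1 h)
  exact ae_eq_indicator_superlevel_of_power_eq (hX.prodMk hX') hA hpos.ne' hcompl hηm hη01 hη
    hGcont hα.2 hQlt hQ hsm hs01 hsfpr hstpr
end

section
/- Define AUC(s) = ∫₀¹ ROC_s(α) dα for measurable s: 𝒳×𝒳 → ℝ₊ and set AUC* = AUC(η) = ∫₀¹ ROC_η(α) dα. Then for every measurable s: 𝒳×𝒳 → ℝ₊: (i) AUC(s) ≤ AUC*, and (ii) ∫₀¹ |ROC_η(α) − ROC_s(α)| dα = AUC* − AUC(s); that is, the L¹ distance D₁(s,s*) between ROC_s and the optimal curve ROC* = ROC_η equals the AUC deficit AUC* − AUC(s). -/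
open MeasureTheory ProbabilityTheory

open Set Filter Topology

/-- The survival function of a real random variable is one minus its cdf. -/
lemma real_setOf_lt_eq_one_sub_cdf {Ω : Type*} [MeasurableSpace Ω] (ν : Measure Ω)
    [IsProbabilityMeasure ν] {f : Ω → ℝ} (hf : Measurable f) (t : ℝ) :
    ν.real {ω | t < f ω} = 1 - cdf (ν.map f) t := by
  have : IsProbabilityMeasure (ν.map f) := Measure.isProbabilityMeasure_map hf.aemeasurable
  have hcompl : {ω | t < f ω} = {ω | f ω ≤ t}ᶜ := by ext; simp
  rw [cdf_eq_real, map_measureReal_apply hf measurableSet_Iic, hcompl,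
    probReal_compl_eq_one_sub (measurableSet_le hf measurable_const)]
  rfl

/-- Above any positive level there is a nonnegative threshold. -/
lemma exists_nonneg_real_setOf_lt_le {Ω : Type*} [MeasurableSpace Ω] (ν : Measure Ω)
    [IsProbabilityMeasure ν] {f : Ω → ℝ} (hf : Measurable f) {α : ℝ} (hα : 0 < α) :
    {t : ℝ | 0 ≤ t ∧ ν.real {ω | t < f ω} ≤ α}.Nonempty := by
  have hlim := tendsto_cdf_atTop (ν.map f)
  obtain ⟨t, ht, ht0⟩ :=
    ((hlim.eventually_const_lt (by linarith : 1 - α < 1)).and (eventually_ge_atTop 0)).exists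
  refine ⟨t, ht0, ?_⟩
  rw [real_setOf_lt_eq_one_sub_cdf ν hf]
  linarith

/-- The infimum defining the generalized inverse of a survival function is attained. -/
lemma real_setOf_sInf_lt_le {Ω : Type*} [MeasurableSpace Ω] (ν : Measure Ω)
    [IsProbabilityMeasure ν] {f : Ω → ℝ} (hf : Measurable f) {α : ℝ} (hα : 0 < α) :
    ν.real {ω | sInf {t : ℝ | 0 ≤ t ∧ ν.real {ω | t < f ω} ≤ α} < f ω} ≤ α := by
  set S := {t : ℝ | 0 ≤ t ∧ ν.real {ω | t < f ω} ≤ α}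
  have hne : S.Nonempty := exists_nonneg_real_setOf_lt_le ν hf hα
  rw [real_setOf_lt_eq_one_sub_cdf ν hf]
  have hlim : Tendsto (fun t => 1 - cdf (ν.map f) t) (𝓝[>] (sInf S))
      (𝓝 (1 - cdf (ν.map f) (sInf S))) :=
    ((((cdf (ν.map f)).right_continuous (sInf S)).mono Ioi_subset_Ici_self).tendsto).const_sub 1
  refine le_of_tendsto hlim ?_
  filter_upwards [self_mem_nhdsWithin] with t ht
  obtain ⟨u, hu, hut⟩ := exists_lt_of_csInf_lt hne ht
  have h1 := hu.2
  rw [real_setOf_lt_eq_one_sub_cdf ν hf] at h1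
  have := monotone_cdf (ν.map f) hut.le
  linarith

/-- Neyman–Pearson: a superlevel set of the posterior probability of `E` has the largest
detection probability among sets with at most its false alarm probability. -/
lemma real_inter_le_real_inter_superlevel {Ω : Type*} [MeasurableSpace Ω] (μ : Measure Ω)
    [IsProbabilityMeasure μ] {E B : Set Ω} (hE : MeasurableSet E) (hB : MeasurableSet B)
    {h : Ω → ℝ} (hm : Measurable h) (hint : Integrable h μ) {t : ℝ} (ht0 : 0 ≤ t) (ht1 : t < 1)
    (hEA : ∫ ω in {ω | t < h ω}, h ω ∂μ = μ.real (E ∩ {ω | t < h ω}))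
    (hEB : ∫ ω in B, h ω ∂μ = μ.real (E ∩ B))
    (hle : μ.real (Eᶜ ∩ B) ≤ μ.real (Eᶜ ∩ {ω | t < h ω})) :
    μ.real (E ∩ B) ≤ μ.real (E ∩ {ω | t < h ω}) := by
  set A := {ω | t < h ω} with hAdef
  have hA : MeasurableSet A := measurableSet_lt measurable_const hm
  have hint' : Integrable (fun ω => h ω - t) μ := hint.sub (integrable_const t)
  have key : ∫ ω in B, (h ω - t) ∂μ ≤ ∫ ω in A, (h ω - t) ∂μ := by
    rw [← integral_indicator hA, ← integral_indicator hB]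
    refine integral_mono (hint'.indicator hB) (hint'.indicator hA) fun ω => ?_
    by_cases h1 : ω ∈ A <;> by_cases h2 : ω ∈ B <;> simp [h1, h2]
    · exact (show t < h ω from h1).le
    · exact not_lt.mp (show ¬ t < h ω from h1)
  have split : ∀ C : Set Ω, MeasurableSet C → ∫ ω in C, (h ω - t) ∂μ =
      ∫ ω in C, h ω ∂μ - t * (μ.real (E ∩ C) + μ.real (Eᶜ ∩ C)) := by
    intro C hC
    have hC' : μ.real (E ∩ C) + μ.real (Eᶜ ∩ C) = μ.real C := by
      rw [inter_comm E, inter_comm Eᶜ, ← sdiff_eq]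
      exact measureReal_inter_add_sdiff hE
    rw [integral_sub hint.integrableOn (integrable_const t).integrableOn, hC']
    simp [mul_comm]
  rw [split A hA, split B hB, hEA, hEB] at key
  nlinarith [mul_le_mul_of_nonneg_left hle ht0]

/-- Conditional probability of an event as a quotient of real numbers. -/
lemma real_cond_eq_inv_mul {Ω : Type*} [MeasurableSpace Ω] (μ : Measure Ω) {E : Set Ω}
    (hE : MeasurableSet E) (C : Set Ω) : (μ[|E]).real C = (μ.real E)⁻¹ * μ.real (E ∩ C) := by
  simp [measureReal_def, cond_apply hE]

/-- For two monotone bounded functions on `(0,1)`, one dominating the other, the `L¹` distance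
is the difference of the integrals. -/
lemma integral_le_and_integral_abs_sub_eq {f g : ℝ → ℝ} (hf : MonotoneOn f (Ioo 0 1))
    (hg : MonotoneOn g (Ioo 0 1)) (hf01 : ∀ x, f x ∈ Icc (0 : ℝ) 1)
    (hg01 : ∀ x, g x ∈ Icc (0 : ℝ) 1) (hle : ∀ x ∈ Ioo (0 : ℝ) 1, f x ≤ g x) :
    (∫ x in (0 : ℝ)..1, f x) ≤ (∫ x in (0 : ℝ)..1, g x) ∧
      (∫ x in (0 : ℝ)..1, |g x - f x|) = (∫ x in (0 : ℝ)..1, g x) - ∫ x in (0 : ℝ)..1, f x := by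
  have hii : ∀ u : ℝ → ℝ, MonotoneOn u (Ioo 0 1) → (∀ x, u x ∈ Icc (0 : ℝ) 1) →
      IntegrableOn u (Ioo 0 1) := by
    intro u hu hu01
    refine Integrable.of_bound
      (aemeasurable_restrict_of_monotoneOn measurableSet_Ioo hu).aestronglyMeasurable 1
      (ae_of_all _ fun x => ?_)
    rw [Real.norm_eq_abs, abs_of_nonneg (hu01 x).1]
    exact (hu01 x).2
  have hfi := hii f hf hf01
  have hgi := hii g hg hg01
  simp only [intervalIntegral.integral_of_le zero_le_one, integral_Ioc_eq_integral_Ioo]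
  refine ⟨setIntegral_mono_on hfi hgi measurableSet_Ioo hle, ?_⟩
  rw [← integral_sub hgi hfi]
  exact setIntegral_congr_fun measurableSet_Ioo fun x hx =>
    abs_of_nonneg (sub_nonneg.mpr (hle x hx))

/-- With `AUC(s) = ∫₀¹ ROC_s(α) dα` and `AUC* = AUC(η)`, one has
`AUC(s) ≤ AUC*` and `∫₀¹ |ROC_η(α) − ROC_s(α)| dα = AUC* − AUC(s)` for every measurable
nonnegative similarity function `s`. -/
theorem l1_distance_to_optimal_roc_eq_auc_deficit
    {Ω : Type*} [MeasurableSpace Ω] (μ : Measure Ω) [IsProbabilityMeasure μ]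
    (d K : ℕ) (hK : 1 ≤ K)
    (X X' : Ω → (Fin d → ℝ)) (Y Y' : Ω → Fin K)
    (hX : Measurable X) (hX' : Measurable X') (hY : Measurable Y) (hY' : Measurable Y')
    (hindep : IndepFun (fun ω => (X ω, Y ω)) (fun ω => (X' ω, Y' ω)) μ)
    (hident : Measure.map (fun ω => (X ω, Y ω)) μ = Measure.map (fun ω => (X' ω, Y' ω)) μ)
    -- `0 < p_+ < 1`
    (hpos : 0 < μ {ω | Y ω = Y' ω}) (hpos' : μ {ω | Y ω = Y' ω} < 1)
    -- the pairwise posterior probability `η(x,x') = ℙ{Y = Y' ∣ (X,X') = (x,x')}`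
    (η : (Fin d → ℝ) × (Fin d → ℝ) → ℝ) (hηm : Measurable η)
    (hη01 : ∀ p, η p ∈ Set.Icc (0 : ℝ) 1)
    (hηver : μ[(fun ω => if Y ω = Y' ω then (1 : ℝ) else 0) |
        MeasurableSpace.comap (fun ω => (X ω, X' ω)) inferInstance]
      =ᵐ[μ] fun ω => η (X ω, X' ω))
    -- conditional "false/true positive rate" functions, generalized inverse and ROC
    (Fm Fp : ((Fin d → ℝ) × (Fin d → ℝ) → ℝ) → ℝ → ℝ)
    (hFm : ∀ s t, Fm s t = (μ[|{ω | Y ω ≠ Y' ω}] {ω | t < s (X ω, X' ω)}).toReal)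
    (hFp : ∀ s t, Fp s t = (μ[|{ω | Y ω = Y' ω}] {ω | t < s (X ω, X' ω)}).toReal)
    (inv : ((Fin d → ℝ) × (Fin d → ℝ) → ℝ) → ℝ → ℝ)
    (hinv : ∀ s α, inv s α = sInf {t : ℝ | 0 ≤ t ∧ Fm s t ≤ α})
    (ROC : ((Fin d → ℝ) × (Fin d → ℝ) → ℝ) → ℝ → ℝ)
    (hROC : ∀ s α, ROC s α = Fp s (inv s α))
    -- the conditional cdf of `η(X,X')` given `Z = −1` is invertible
    (hGcont : Continuous
      (fun t : ℝ => (μ[|{ω | Y ω ≠ Y' ω}] {ω | η (X ω, X' ω) ≤ t}).toReal))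
    (hGmono : StrictMonoOn
      (fun t : ℝ => (μ[|{ω | Y ω ≠ Y' ω}] {ω | η (X ω, X' ω) ≤ t}).toReal)
      (Set.Icc (0 : ℝ) 1)) :
    ∀ s : (Fin d → ℝ) × (Fin d → ℝ) → ℝ, Measurable s → (∀ p, 0 ≤ s p) →
      (∫ α in (0 : ℝ)..1, ROC s α) ≤ (∫ α in (0 : ℝ)..1, ROC η α) ∧
        (∫ α in (0 : ℝ)..1, |ROC η α - ROC s α|) =
          (∫ α in (0 : ℝ)..1, ROC η α) - ∫ α in (0 : ℝ)..1, ROC s α := by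
  intro s hs _
  set E : Set Ω := {ω | Y ω = Y' ω} with hEdef
  have hE : MeasurableSet E := measurableSet_eq_fun hY hY'
  have hEc : {ω | Y ω ≠ Y' ω} = Eᶜ := rfl
  have hXX : Measurable fun ω => (X ω, X' ω) := hX.prodMk hX'
  have hEcpos : μ Eᶜ ≠ 0 := by
    rw [prob_compl_eq_one_sub hE]
    exact (tsub_pos_of_lt hpos').ne'
  have : IsProbabilityMeasure (μ[|Eᶜ]) := cond_isProbabilityMeasure hEcpos
  have : IsProbabilityMeasure (μ[|E]) := cond_isProbabilityMeasure hpos.ne'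
  rw [hEc] at hFm hGcont
  have hFm' : ∀ u t, Fm u t = (μ[|Eᶜ]).real {ω | t < u (X ω, X' ω)} := hFm
  have hFp' : ∀ u t, Fp u t = (μ[|E]).real {ω | t < u (X ω, X' ω)} := hFp
  have hFp_anti : ∀ u, Antitone (Fp u) := fun u a b hab => by
    rw [hFp', hFp']
    exact measureReal_mono fun ω (hω : b < _) => lt_of_le_of_lt hab hω
  have hFm_anti : ∀ u, Antitone (Fm u) := fun u a b hab => by
    rw [hFm', hFm']
    exact measureReal_mono fun ω (hω : b < _) => lt_of_le_of_lt hab hω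
  have hROC01 : ∀ u α, ROC u α ∈ Icc (0 : ℝ) 1 := fun u α => by
    rw [hROC, hFp']
    exact ⟨measureReal_nonneg, measureReal_le_one⟩
  have hbdd : ∀ u α, BddBelow {t : ℝ | 0 ≤ t ∧ Fm u t ≤ α} := fun u α => ⟨0, fun t ht => ht.1⟩
  have hne : ∀ u, Measurable u → ∀ α, 0 < α → {t : ℝ | 0 ≤ t ∧ Fm u t ≤ α}.Nonempty := by
    intro u hu α hα
    simp only [hFm']
    exact exists_nonneg_real_setOf_lt_le _ (hu.comp hXX) hα
  have hFm_inv : ∀ u, Measurable u → ∀ α, 0 < α → Fm u (inv u α) ≤ α := by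
    intro u hu α hα
    rw [hinv]
    simp only [hFm']
    exact real_setOf_sInf_lt_le _ (hu.comp hXX) hα
  have hROC_mono : ∀ u, Measurable u → MonotoneOn (ROC u) (Ioo 0 1) := by
    intro u hu a ha b _ hab
    rw [hROC, hROC]
    refine hFp_anti u ?_
    rw [hinv, hinv]
    exact csInf_le_csInf (hbdd u b) (hne u hu a ha.1) fun t ht => ⟨ht.1, ht.2.trans hab⟩
  have hFmG : ∀ t, Fm η t = 1 - ((μ[|Eᶜ]) {ω | η (X ω, X' ω) ≤ t}).toReal := by
    intro t
    have hcompl : {ω | t < η (X ω, X' ω)} = {ω | η (X ω, X' ω) ≤ t}ᶜ := by ext; simp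
    have hmeas : MeasurableSet {ω | η (X ω, X' ω) ≤ t} :=
      measurableSet_le (hηm.comp hXX) measurable_const
    rw [hFm', hcompl, probReal_compl_eq_one_sub hmeas, measureReal_def]
  have hFm_cont : Continuous (Fm η) := by
    rw [funext hFmG]
    exact continuous_const.sub hGcont
  have hFm_neg : ∀ t < 0, Fm η t = 1 := by
    intro t ht
    have huniv : {ω | t < η (X ω, X' ω)} = univ :=
      eq_univ_of_forall fun ω => lt_of_lt_of_le ht (hη01 _).1
    rw [hFm', huniv, probReal_univ]
  have hFm_zero : Fm η 0 = 1 := by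
    refine tendsto_nhds_unique
      ((hFm_cont.tendsto 0).mono_left (nhdsWithin_le_nhds (s := Iio 0))) ?_
    refine tendsto_const_nhds.congr' ?_
    filter_upwards [self_mem_nhdsWithin] with t ht using (hFm_neg t ht).symm
  have hFm_one : Fm η 1 = 0 := by
    have hempty : {ω | 1 < η (X ω, X' ω)} = ∅ :=
      eq_empty_of_forall_notMem fun ω (hω : 1 < _) => not_lt.mpr (hη01 (X ω, X' ω)).2 hω
    rw [hFm', hempty, measureReal_empty]
  have hFm_inv_eta : ∀ α ∈ Ioo (0 : ℝ) 1, Fm η (inv η α) = α := by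
    intro α hα
    refine le_antisymm (hFm_inv η hηm α hα.1) ?_
    obtain ⟨t, ht, htα⟩ := intermediate_value_Icc' zero_le_one hFm_cont.continuousOn
      (show α ∈ Icc (Fm η 1) (Fm η 0) by rw [hFm_zero, hFm_one]; exact ⟨hα.1.le, hα.2.le⟩)
    calc α = Fm η t := htα.symm
      _ ≤ Fm η (inv η α) := hFm_anti η (by
          rw [hinv]; exact csInf_le (hbdd η α) ⟨ht.1, htα.le⟩)
  have hint : Integrable (fun ω => η (X ω, X' ω)) μ :=
    Integrable.of_bound (hηm.comp hXX).aestronglyMeasurable 1 (ae_of_all _ fun ω => by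
      rw [Real.norm_eq_abs, abs_of_nonneg (hη01 _).1]; exact (hη01 _).2)
  have hind : (fun ω => if Y ω = Y' ω then (1 : ℝ) else 0) = E.indicator 1 := by
    ext ω
    simp [hEdef, indicator_apply]
  have hpost : ∀ C : Set ((Fin d → ℝ) × (Fin d → ℝ)), MeasurableSet C →
      ∫ ω in (fun ω => (X ω, X' ω)) ⁻¹' C, η (X ω, X' ω) ∂μ =
        μ.real (E ∩ (fun ω => (X ω, X' ω)) ⁻¹' C) := by
    intro C hC
    rw [← setIntegral_congr_ae (hXX hC) (hηver.mono fun ω hω _ => hω),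
      setIntegral_condExp hXX.comap_le
        (by rw [hind]; exact (integrable_const 1).indicator hE) ⟨C, hC, rfl⟩,
      hind, integral_indicator_one hE, measureReal_restrict_apply hE]
  refine integral_le_and_integral_abs_sub_eq (hROC_mono s hs) (hROC_mono η hηm) (hROC01 s)
    (hROC01 η) fun α hα => ?_
  have hinv0 : 0 ≤ inv η α := by
    rw [hinv]
    exact le_csInf (hne η hηm α hα.1) fun t ht => ht.1
  have hinv1 : inv η α < 1 := by
    by_contra! hge
    have := hFm_anti η hge
    rw [hFm_inv_eta α hα, hFm_one] at this
    exact not_lt.mpr this hα.1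
  have hfalse : Fm s (inv s α) ≤ Fm η (inv η α) :=
    (hFm_inv s hs α hα.1).trans (hFm_inv_eta α hα).ge
  rw [hFm', hFm', real_cond_eq_inv_mul μ hE.compl, real_cond_eq_inv_mul μ hE.compl] at hfalse
  have hEc_real : 0 < (μ.real Eᶜ)⁻¹ := inv_pos.mpr (ENNReal.toReal_pos hEcpos (measure_ne_top μ _))
  rw [hROC, hROC, hFp', hFp', real_cond_eq_inv_mul μ hE, real_cond_eq_inv_mul μ hE]
  refine mul_le_mul_of_nonneg_left ?_ (inv_nonneg.mpr measureReal_nonneg)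
  exact real_inter_le_real_inter_superlevel μ hE (hXX (measurableSet_lt measurable_const hs))
    (hηm.comp hXX) hint hinv0 hinv1 (hpost _ (measurableSet_lt measurable_const hηm))
    (hpost _ (measurableSet_lt measurable_const hs)) (le_of_mul_le_mul_left hfalse hEc_real)
end

section
/- Let C_0, C_1, …, C_L be pairwise disjoint measurable subsets of 𝒳×𝒳 whose union is 𝒳×𝒳, fix an index j ∈ {0,…,L}, and write C_j = C' ∪ C'' with C', C'' disjoint measurable sets. Let s = Σ_{l=0}^L v_l·𝟙_{C_l} with v_0 > v_1 > ⋯ > v_L ≥ 0, and let s' be the refined similarity function that agrees with s outside C_j and takes two values w' > w'' on C' and C'' respectively, with v_{l} > w' > w'' > v_{l'} whenever l < j < l' (so the order of all other cells is preserved and C' is ranked above C''). Assume F_+(C_j) > 0 and F_−(C_j) > 0. Then, with the concordance AUC, AUC(s') − AUC(s) = (1/2)·F_−(C_j)·F_+(C_j)·(1 − Λ(C' ∣ C_j)), where Λ(C' ∣ C_j) = F_+(C_j ∖ C')/F_+(C_j) + F_−(C')/F_−(C_j). -/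
open MeasureTheory ProbabilityTheory
open Classical

/-- Conditionally on independent events, independent random variables give product events
the product of the separate conditional probabilities. -/
theorem cond_inter_toReal_eq_mul {Ω α β : Type*} [MeasurableSpace Ω] [MeasurableSpace α]
    [MeasurableSpace β] {μ : Measure Ω} {U : Ω → α} {V : Ω → β}
    (hU : Measurable U) (hV : Measurable V) (hUV : IndepFun U V μ)
    {S A : Set α} {T D : Set β} (hS : MeasurableSet S) (hA : MeasurableSet A)
    (hT : MeasurableSet T) (hD : MeasurableSet D) :
    (μ[|U ⁻¹' S ∩ V ⁻¹' T] (U ⁻¹' A ∩ V ⁻¹' D)).toReal =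
      (μ[|U ⁻¹' S] (U ⁻¹' A)).toReal * (μ[|V ⁻¹' T] (V ⁻¹' D)).toReal := by
  rw [cond_apply ((hU hS).inter (hV hT)), cond_apply (hU hS), cond_apply (hV hT),
    Set.inter_inter_inter_comm, ← Set.preimage_inter, ← Set.preimage_inter,
    hUV.measure_inter_preimage_eq_mul _ _ hS hT,
    hUV.measure_inter_preimage_eq_mul _ _ (hS.inter hA) (hT.inter hD)]
  simp only [ENNReal.toReal_mul, ENNReal.toReal_inv, mul_inv]
  ring

/-- Conditional probabilities of events depending on a random variable are determined by
its law. -/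
theorem cond_preimage_congr_of_map_eq {Ω α : Type*} [MeasurableSpace Ω] [MeasurableSpace α]
    {μ : Measure Ω} {U V : Ω → α} (hU : Measurable U) (hV : Measurable V)
    (h : Measure.map U μ = Measure.map V μ) {S A : Set α}
    (hS : MeasurableSet S) (hA : MeasurableSet A) :
    μ[|U ⁻¹' S] (U ⁻¹' A) = μ[|V ⁻¹' S] (V ⁻¹' A) := by
  rw [cond_apply (hU hS), cond_apply (hV hS), ← Set.preimage_inter, ← Set.preimage_inter,
    ← Measure.map_apply hU hS, ← Measure.map_apply hU (hS.inter hA), h,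
    Measure.map_apply hV hS, Measure.map_apply hV (hS.inter hA)]

/-- A linear combination of indicators of disjoint sets takes on each set the corresponding
coefficient. -/
theorem sum_mul_indicator_eq_of_mem {α : Type*} {L : ℕ} {C : ℕ → Set α} {v : ℕ → ℝ}
    (hdisj : ∀ i ≤ L, ∀ j ≤ L, i ≠ j → Disjoint (C i) (C j))
    {l : ℕ} (hl : l ≤ L) {p : α} (hp : p ∈ C l) :
    ∑ i ∈ Finset.range (L + 1), v i * Set.indicator (C i) (fun _ => 1) p = v l := by
  rw [Finset.sum_eq_single l]
  · simp [hp]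
  · intro i hi hne
    have hpi : p ∉ C i := fun hpi =>
      Set.disjoint_left.mp (hdisj i (by simpa [Nat.lt_succ_iff] using hi) l hl hne) hpi hp
    simp [hpi]
  · intro h
    simp at h
    omega

/-- If refining a score `s`, constant on `A ∪ B`, so that it takes the values `b < a` on `B` and
`A` leaves the comparisons of pairs outside `(A ∪ B) ×ˢ (A ∪ B)` unchanged, then the probability
of concordance with ties counted by half changes only through pairs in `A ∪ B`. -/
theorem concordance_sub_eq_of_refine {Ω α : Type*} [MeasurableSpace Ω] [MeasurableSpace α]
    {ν : Measure Ω} [IsFiniteMeasure ν] {P Q : Ω → α} (hP : Measurable P) (hQ : Measurable Q)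
    {A B : Set α} (hA : MeasurableSet A) (hB : MeasurableSet B) (hAB : Disjoint A B)
    {s t : α → ℝ} {a b c : ℝ} (hba : b < a) (hs : ∀ p ∈ A ∪ B, s p = c)
    (htA : ∀ p ∈ A, t p = a) (htB : ∀ p ∈ B, t p = b)
    (hlt : ∀ p q, ¬(p ∈ A ∪ B ∧ q ∈ A ∪ B) → (t p < t q ↔ s p < s q))
    (heq : ∀ p q, ¬(p ∈ A ∪ B ∧ q ∈ A ∪ B) → (t p = t q ↔ s p = s q)) :
    (ν.real {ω | t (P ω) < t (Q ω)} + 1 / 2 * ν.real {ω | t (P ω) = t (Q ω)}) -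
        (ν.real {ω | s (P ω) < s (Q ω)} + 1 / 2 * ν.real {ω | s (P ω) = s (Q ω)}) =
      ν.real (P ⁻¹' B ∩ Q ⁻¹' A) +
        1 / 2 * (ν.real (P ⁻¹' A ∩ Q ⁻¹' A) + ν.real (P ⁻¹' B ∩ Q ⁻¹' B)) -
        1 / 2 * ν.real (P ⁻¹' (A ∪ B) ∩ Q ⁻¹' (A ∪ B)) := by
  set E : Set Ω := P ⁻¹' (A ∪ B) ∩ Q ⁻¹' (A ∪ B) with hE
  have hEm : MeasurableSet E := (hP (hA.union hB)).inter (hQ (hA.union hB))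
  have hlt' : {ω | t (P ω) < t (Q ω)} \ E = {ω | s (P ω) < s (Q ω)} \ E := by
    ext ω
    exact and_congr_left fun h => hlt _ _ h
  have heq' : {ω | t (P ω) = t (Q ω)} \ E = {ω | s (P ω) = s (Q ω)} \ E := by
    ext ω
    exact and_congr_left fun h => heq _ _ h
  have hslt : {ω | s (P ω) < s (Q ω)} ∩ E = ∅ := by
    ext ω
    simp only [Set.mem_inter_iff, Set.mem_ofPred_eq, Set.mem_empty_iff_false, iff_false, not_and]
    rintro h ⟨h₁, h₂⟩
    rw [hs _ h₁, hs _ h₂] at h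
    exact lt_irrefl _ h
  have hseq : {ω | s (P ω) = s (Q ω)} ∩ E = E :=
    Set.inter_eq_right.mpr fun ω h => (hs _ h.1).trans (hs _ h.2).symm
  have hdis : ∀ p, p ∈ A → p ∉ B := fun _ h => Set.disjoint_left.mp hAB h
  have htlt : {ω | t (P ω) < t (Q ω)} ∩ E = P ⁻¹' B ∩ Q ⁻¹' A := by
    ext ω
    simp only [hE, Set.mem_inter_iff, Set.mem_ofPred_eq, Set.mem_preimage, Set.mem_union]
    constructor
    · rintro ⟨h, h₁ | h₁, h₂ | h₂⟩ <;> simp only [htA, htB, h₁, h₂] at h ⊢ <;>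
        first | exact ⟨trivial, trivial⟩ | exact absurd h (by linarith)
    · rintro ⟨h₁, h₂⟩
      rw [htB _ h₁, htA _ h₂]
      exact ⟨hba, Or.inr h₁, Or.inl h₂⟩
  have hteq : {ω | t (P ω) = t (Q ω)} ∩ E = (P ⁻¹' A ∩ Q ⁻¹' A) ∪ (P ⁻¹' B ∩ Q ⁻¹' B) := by
    ext ω
    simp only [hE, Set.mem_inter_iff, Set.mem_ofPred_eq, Set.mem_preimage, Set.mem_union]
    constructor
    · rintro ⟨h, h₁ | h₁, h₂ | h₂⟩
      · exact Or.inl ⟨h₁, h₂⟩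
      · exact absurd (htA _ h₁ ▸ htB _ h₂ ▸ h) hba.ne'
      · exact absurd (htB _ h₁ ▸ htA _ h₂ ▸ h) hba.ne
      · exact Or.inr ⟨h₁, h₂⟩
    · rintro (⟨h₁, h₂⟩ | ⟨h₁, h₂⟩)
      · exact ⟨(htA _ h₁).trans (htA _ h₂).symm, Or.inl h₁, Or.inl h₂⟩
      · exact ⟨(htB _ h₁).trans (htB _ h₂).symm, Or.inr h₁, Or.inr h₂⟩
  have hunion : ν.real ((P ⁻¹' A ∩ Q ⁻¹' A) ∪ (P ⁻¹' B ∩ Q ⁻¹' B)) =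
      ν.real (P ⁻¹' A ∩ Q ⁻¹' A) + ν.real (P ⁻¹' B ∩ Q ⁻¹' B) :=
    measureReal_union (Set.disjoint_left.mpr fun ω h h' => hdis _ h.1 h'.1)
      ((hP hB).inter (hQ hB))
  rw [← measureReal_inter_add_sdiff (s := {ω | t (P ω) < t (Q ω)}) hEm,
    ← measureReal_inter_add_sdiff (s := {ω | t (P ω) = t (Q ω)}) hEm,
    ← measureReal_inter_add_sdiff (s := {ω | s (P ω) < s (Q ω)}) hEm,
    ← measureReal_inter_add_sdiff (s := {ω | s (P ω) = s (Q ω)}) hEm,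
    hlt', heq', hslt, hseq, htlt, hteq, hunion, measureReal_empty]
  ring

/-- Splitting the cell `C_j = C' ∪ C''` of a piecewise constant similarity
function and ranking `C'` above `C''` increases the concordance AUC by
`½ F_−(C_j) F_+(C_j) (1 − Λ(C' ∣ C_j))` where
`Λ(C' ∣ C_j) = F_+(C_j ∖ C')/F_+(C_j) + F_−(C')/F_−(C_j)`. -/
theorem auc_increment_of_cell_split
    {Ω : Type*} [MeasurableSpace Ω] (μ : Measure Ω) [IsProbabilityMeasure μ]
    (d K : ℕ) (hK : 1 ≤ K)
    (X X' : Ω → (Fin d → ℝ)) (Y Y' : Ω → Fin K)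
    (hX : Measurable X) (hX' : Measurable X') (hY : Measurable Y) (hY' : Measurable Y')
    (hindep : IndepFun (fun ω => (X ω, Y ω)) (fun ω => (X' ω, Y' ω)) μ)
    (hident : Measure.map (fun ω => (X ω, Y ω)) μ = Measure.map (fun ω => (X' ω, Y' ω)) μ)
    -- `0 < p_+ < 1`
    (hpos : 0 < μ {ω | Y ω = Y' ω}) (hpos' : μ {ω | Y ω = Y' ω} < 1)
    -- `((X₁,X₁'),Z₁)` and `((X₂,X₂'),Z₂)`: independent copies of `((X,X'),Z)`
    (X₁ X₁' X₂ X₂' : Ω → (Fin d → ℝ)) (Z₁ Z₂ : Ω → ℝ)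
    (hX₁ : Measurable X₁) (hX₁' : Measurable X₁') (hX₂ : Measurable X₂)
    (hX₂' : Measurable X₂') (hZ₁ : Measurable Z₁) (hZ₂ : Measurable Z₂)
    (hcopy₁ : Measure.map (fun ω => ((X₁ ω, X₁' ω), Z₁ ω)) μ =
      Measure.map (fun ω => ((X ω, X' ω), if Y ω = Y' ω then (1 : ℝ) else -1)) μ)
    (hcopy₂ : Measure.map (fun ω => ((X₂ ω, X₂' ω), Z₂ ω)) μ =
      Measure.map (fun ω => ((X ω, X' ω), if Y ω = Y' ω then (1 : ℝ) else -1)) μ)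
    (hindep₁₂ : IndepFun (fun ω => ((X₁ ω, X₁' ω), Z₁ ω))
      (fun ω => ((X₂ ω, X₂' ω), Z₂ ω)) μ)
    -- the concordance AUC functional
    (AUC : ((Fin d → ℝ) × (Fin d → ℝ) → ℝ) → ℝ)
    (hAUC : ∀ s', AUC s' =
      (μ[|{ω | Z₁ ω = -1 ∧ Z₂ ω = 1}]
          {ω | s' (X₁ ω, X₁' ω) < s' (X₂ ω, X₂' ω)}).toReal +
        (1 / 2) * (μ[|{ω | Z₁ ω = -1 ∧ Z₂ ω = 1}]
          {ω | s' (X₁ ω, X₁' ω) = s' (X₂ ω, X₂' ω)}).toReal)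
    -- conditional probabilities of the cells
    (Fmc Fpc : Set ((Fin d → ℝ) × (Fin d → ℝ)) → ℝ)
    (hFmc : ∀ A, Fmc A = (μ[|{ω | Y ω ≠ Y' ω}] {ω | (X ω, X' ω) ∈ A}).toReal)
    (hFpc : ∀ A, Fpc A = (μ[|{ω | Y ω = Y' ω}] {ω | (X ω, X' ω) ∈ A}).toReal)
    -- the measurable partition `C_0, …, C_L` of `𝒳 × 𝒳` and the values `v_0 > ⋯ > v_L ≥ 0`
    (L : ℕ) (C : ℕ → Set ((Fin d → ℝ) × (Fin d → ℝ)))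
    (hCmeas : ∀ l ≤ L, MeasurableSet (C l))
    (hCdisj : ∀ i ≤ L, ∀ j ≤ L, i ≠ j → Disjoint (C i) (C j))
    (hCcov : (⋃ l ∈ Finset.range (L + 1), C l) = Set.univ)
    (v : ℕ → ℝ) (hvmono : ∀ i j, i < j → j ≤ L → v j < v i) (hvL : 0 ≤ v L)
    -- the piecewise constant similarity function `s = Σ_l v_l 𝟙_{C_l}`
    (s : (Fin d → ℝ) × (Fin d → ℝ) → ℝ)
    (hs : ∀ p, s p = ∑ l ∈ Finset.range (L + 1), v l * Set.indicator (C l) (fun _ => 1) p)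
    -- the split `C_j = C' ∪ C''` of the cell `C_j` into disjoint measurable subsets
    (j : ℕ) (hj : j ≤ L)
    (C' C'' : Set ((Fin d → ℝ) × (Fin d → ℝ)))
    (hC'meas : MeasurableSet C') (hC''meas : MeasurableSet C'')
    (hsplit : C' ∪ C'' = C j) (hdisj : Disjoint C' C'')
    -- the refined values `w' > w''`, interleaved with the `v_l`'s
    (w' w'' : ℝ) (hw : w'' < w')
    (hw' : ∀ l < j, w' < v l) (hw'' : ∀ l', j < l' → l' ≤ L → v l' < w'')
    -- the refined similarity function `s'`
    (s' : (Fin d → ℝ) × (Fin d → ℝ) → ℝ)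
    (hs' : ∀ p, s' p = if p ∈ C' then w' else if p ∈ C'' then w'' else s p)
    -- `F_+(C_j) > 0` and `F_−(C_j) > 0`
    (hFpCj : 0 < Fpc (C j)) (hFmCj : 0 < Fmc (C j)) :
    AUC s' - AUC s =
      (1 / 2) * Fmc (C j) * Fpc (C j) *
        (1 - (Fpc (C j \ C') / Fpc (C j) + Fmc C' / Fmc (C j))) := by
  have hW : Measurable fun ω => ((X ω, X' ω), if Y ω = Y' ω then (1 : ℝ) else -1) :=
    (hX.prodMk hX').prodMk
      (Measurable.ite (measurableSet_eq_fun hY hY') measurable_const measurable_const)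
  have hW₁ : Measurable fun ω => ((X₁ ω, X₁' ω), Z₁ ω) := (hX₁.prodMk hX₁').prodMk hZ₁
  have hW₂ : Measurable fun ω => ((X₂ ω, X₂' ω), Z₂ ω) := (hX₂.prodMk hX₂').prodMk hZ₂
  have hlabel (z : ℝ) : MeasurableSet
      (Prod.snd ⁻¹' {z} : Set (((Fin d → ℝ) × (Fin d → ℝ)) × ℝ)) :=
    measurable_snd (measurableSet_singleton z)
  set B : Set Ω := {ω | Z₁ ω = -1 ∧ Z₂ ω = 1}
  have hprod (A D : Set ((Fin d → ℝ) × (Fin d → ℝ))) (hA : MeasurableSet A)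
      (hD : MeasurableSet D) :
      (μ[|B]).real ((fun ω => (X₁ ω, X₁' ω)) ⁻¹' A ∩ (fun ω => (X₂ ω, X₂' ω)) ⁻¹' D) =
        Fmc A * Fpc D := by
    have hm : {ω | Y ω ≠ Y' ω} =
        (fun ω => ((X ω, X' ω), if Y ω = Y' ω then (1 : ℝ) else -1)) ⁻¹'
          (Prod.snd ⁻¹' {(-1 : ℝ)}) := by
      ext ω
      by_cases h : Y ω = Y' ω <;> simp [h]
      norm_num
    have hp : {ω | Y ω = Y' ω} =
        (fun ω => ((X ω, X' ω), if Y ω = Y' ω then (1 : ℝ) else -1)) ⁻¹'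
          (Prod.snd ⁻¹' {(1 : ℝ)}) := by
      ext ω
      by_cases h : Y ω = Y' ω <;> simp [h]
      norm_num
    have key := cond_inter_toReal_eq_mul hW₁ hW₂ hindep₁₂ (hlabel (-1)) (measurable_fst hA)
      (hlabel 1) (measurable_fst hD)
    rw [cond_preimage_congr_of_map_eq hW₁ hW hcopy₁ (hlabel (-1)) (measurable_fst hA),
      cond_preimage_congr_of_map_eq hW₂ hW hcopy₂ (hlabel 1) (measurable_fst hD),
      ← hm, ← hp] at key
    rw [hFmc, hFpc]
    exact key
  have hFm_union : Fmc (C j) = Fmc C' + Fmc C'' := by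
    simp only [hFmc]
    rw [← hsplit]
    exact measureReal_union (hdisj.preimage fun ω => (X ω, X' ω)) ((hX.prodMk hX') hC''meas)
  have hFp_union : Fpc (C j) = Fpc C' + Fpc C'' := by
    simp only [hFpc]
    rw [← hsplit]
    exact measureReal_union (hdisj.preimage fun ω => (X ω, X' ω)) ((hX.prodMk hX') hC''meas)
  have hdiff : C j \ C' = C'' := by
    rw [← hsplit, Set.union_sdiff_left, hdisj.symm.sdiff_eq_left]
  have hsC {l : ℕ} (hl : l ≤ L) {p} (hp : p ∈ C l) : s p = v l :=
    (hs p).trans (sum_mul_indicator_eq_of_mem hCdisj hl hp)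
  have htA (p) (hp : p ∈ C') : s' p = w' := by simp [hs', hp]
  have htB (p) (hp : p ∈ C'') : s' p = w'' := by
    simp [hs', hp, Set.disjoint_right.mp hdisj hp]
  have hmem {p} (hp : p ∈ C j) : s p = v j ∧ w'' ≤ s' p ∧ s' p ≤ w' := by
    refine ⟨hsC hj hp, ?_⟩
    rw [← hsplit] at hp
    rcases hp with hp | hp
    · simp [htA p hp, hw.le]
    · simp [htB p hp, hw.le]
  have hnot {p} (hp : p ∉ C j) :
      s' p = s p ∧ ((v j < s p ∧ w' < s p) ∨ (s p < v j ∧ s p < w'')) := by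
    have hp' := hp
    rw [← hsplit, Set.mem_union, not_or] at hp'
    refine ⟨by simp [hs', hp'.1, hp'.2], ?_⟩
    obtain ⟨l, hl, hpl⟩ : ∃ l ≤ L, p ∈ C l := by
      have := hCcov.symm ▸ Set.mem_univ p
      simpa [Nat.lt_succ_iff] using this
    rw [hsC hl hpl]
    rcases lt_trichotomy l j with h | rfl | h
    · exact Or.inl ⟨hvmono l j h hj, hw' l h⟩
    · exact absurd hpl hp
    · exact Or.inr ⟨hvmono j l h hl, hw'' l h hl⟩
  have hcompare (p q) (h : ¬(p ∈ C' ∪ C'' ∧ q ∈ C' ∪ C'')) :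
      (s' p < s' q ↔ s p < s q) ∧ (s' p = s' q ↔ s p = s q) := by
    rw [hsplit] at h
    by_cases hp : p ∈ C j <;> by_cases hq : q ∈ C j
    · exact absurd ⟨hp, hq⟩ h
    · obtain ⟨h₁, h₂, h₃⟩ := hmem hp
      obtain ⟨h₄, h₅ | h₅⟩ := hnot hq <;> grind
    · obtain ⟨h₁, h₂, h₃⟩ := hmem hq
      obtain ⟨h₄, h₅ | h₅⟩ := hnot hp <;> grind
    · rw [(hnot hp).1, (hnot hq).1]
      exact ⟨Iff.rfl, Iff.rfl⟩
  have hincr := concordance_sub_eq_of_refine (ν := μ[|B]) (hX₁.prodMk hX₁') (hX₂.prodMk hX₂')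
    hC'meas hC''meas hdisj hw (fun p hp => (hmem (hsplit ▸ hp)).1) htA htB
    (fun p q h => (hcompare p q h).1) (fun p q h => (hcompare p q h).2)
  rw [hprod _ _ hC''meas hC'meas, hprod _ _ hC'meas hC'meas, hprod _ _ hC''meas hC''meas,
    hprod _ _ (hC'meas.union hC''meas) (hC'meas.union hC''meas), hsplit] at hincr
  rw [hAUC, hAUC, hdiff]
  refine hincr.trans ?_
  have hm0 := hFmCj.ne'
  have hp0 := hFpCj.ne'
  field_simp
  rw [hFm_union, hFp_union]
  ring
end
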